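/- Sum of factorization binomial coefficients: For every positive integer n: ∑_{d | n} (n choose d)_f = 2^{Ω(n)}. -/

import Mathlib

open Finset ArithmeticFunction

/-- The factorization binomial coefficient
`(n choose d)_f = ∏_{p prime} C(ν_p(n), ν_p(d)) = f(n)/(f(d)·f(n/d))`,
where `f(n) = ∏_p (ν_p(n))!`. -/
def fChoose (n d : ℕ) : ℕ :=
  ∏ p ∈ n.primeFactors, Nat.choose (padicValNat p n) (padicValNat p d)

theorem fChoose_mul_aux (a b d e : ℕ) (hab : Nat.Coprime a b) (ha : a ≠ 0) (hb : b ≠ 0)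
    (hd : d ∣ a) (he : e ∣ b) : fChoose (a * b) (d * e) = fChoose a d * fChoose b e := by
  have key : ∀ x y : ℕ, Nat.Coprime x y → x ≠ 0 → ∀ z, z ∣ y →
      ∀ p ∈ x.primeFactors, padicValNat p z = 0 := by
    intro x y hxy hx z hz p hp
    apply padicValNat.eq_zero_of_not_dvd
    intro h
    have hpp := Nat.prime_of_mem_primeFactors hp
    exact Nat.not_coprime_of_dvd_of_dvd hpp.one_lt (Nat.dvd_of_mem_primeFactors hp)
      (h.trans hz) hxy
  have hd0 : d ≠ 0 := ne_zero_of_dvd_ne_zero ha hd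
  have he0 : e ≠ 0 := ne_zero_of_dvd_ne_zero hb he
  unfold fChoose
  rw [hab.primeFactors_mul, Finset.prod_union hab.disjoint_primeFactors]
  congr 1
  · refine Finset.prod_congr rfl fun p hp => ?_
    have : Fact p.Prime := ⟨Nat.prime_of_mem_primeFactors hp⟩
    rw [padicValNat.mul ha hb, padicValNat.mul hd0 he0, key a b hab ha b dvd_rfl p hp,
      key a b hab ha e he p hp, add_zero, add_zero]
  · refine Finset.prod_congr rfl fun p hp => ?_
    have : Fact p.Prime := ⟨Nat.prime_of_mem_primeFactors hp⟩
    rw [padicValNat.mul ha hb, padicValNat.mul hd0 he0, key b a hab.symm hb a dvd_rfl p hp,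
      key b a hab.symm hb d hd p hp, zero_add, zero_add]

/-- Sum of factorization binomial coefficients: `∑_{d ∣ n} (n choose d)_f = 2^{Ω(n)}`. -/
theorem fChoose_sum (n : ℕ) (hn : 0 < n) :
    ∑ d ∈ n.divisors, fChoose n d = 2 ^ (cardFactors n) := by
  induction n using Nat.recOnPosPrimePosCoprime with
  | zero => omega
  | one => simp [fChoose]
  | prime_pow p k hp hk =>
    have : Fact p.Prime := ⟨hp⟩
    rw [Nat.sum_divisors_prime_pow hp, cardFactors_apply_prime_pow hp, ← Nat.sum_range_choose]
    refine Finset.sum_congr rfl fun i _ => ?_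
    simp [fChoose, Nat.primeFactors_prime_pow hk.ne' hp]
  | coprime a b ha hb hab iha ihb =>
    rw [cardFactors_mul (by omega) (by omega), pow_add, ← iha (by omega), ← ihb (by omega)]
    rw [Finset.sum_mul_sum, ← Finset.sum_product']
    rw [hab.divisors_mul, Finset.sum_map, ← Finset.sum_attach (a.divisors ×ˢ b.divisors)]
    refine Finset.sum_congr rfl fun x _ => ?_
    have hx := Finset.mem_product.1 x.2
    exact fChoose_mul_aux a b _ _ hab (by omega) (by omega) (Nat.dvd_of_mem_divisors hx.1)
      (Nat.dvd_of_mem_divisors hx.2)
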